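/- arXiv:1209.5789 — 4 statements merged into one kernel-verified Lean document; each statement's English description precedes it below -/
import Mathlib

section
/- Let $T$ be a finite tree with vertex set $\{v_0, v_1, \dots, v_m\}$ and edge set $\{f_1,\dots,f_m\}$, let $w : \{1,\dots,m\} \to \mathbb{Z}$ assign an integer weight to each edge, and let $\varepsilon_{jk} \in \{+1,-1\}$ be arbitrary signs. Define the matrix $M \in \mathrm{Mat}_{m \times m}(\mathbb{Z})$ by $M_{jk} = \varepsilon_{jk}\, w(k)$ if the edge $f_k$ lies on the unique path in $T$ from $v_0$ to $v_j$, and $M_{jk} = 0$ otherwise. Then $|\det M| = \prod_{k=1}^m |w(k)|$. (This is Lemma 4.3: in the local coordinates of a cone of tropical covers, the evaluation map is a square matrix whose determinant has absolute value equal to the product of the weights of the bounded edges.) -/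
open scoped Classical

lemma det_of_depth {n : ℕ} (N : Matrix (Fin n) (Fin n) ℤ) (d : Fin n → ℕ)
    (h : ∀ j k, j ≠ k → N j k ≠ 0 → d k < d j) : N.det = ∏ i, N i i := by
  rw [Matrix.det_apply, Finset.sum_eq_single 1]
  · simp
  · intro τ _ hτ
    have : ∏ i, N (τ i) i = 0 := by
      by_contra hne
      rw [← ne_eq, Finset.prod_ne_zero_iff] at hne
      obtain ⟨i, hi⟩ : ∃ i, τ i ≠ i := by
        by_contra hc
        push Not at hc
        exact hτ (Equiv.ext hc)
      have hlt : ∑ i, d i < ∑ i, d (τ i) := by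
        apply Finset.sum_lt_sum
        · intro k _
          by_cases hk : τ k = k
          · rw [hk]
          · exact (h _ _ hk (hne k (Finset.mem_univ _))).le
        · exact ⟨i, Finset.mem_univ _, h _ _ hi (hne i (Finset.mem_univ _))⟩
      rw [Equiv.sum_comp τ d] at hlt
      exact lt_irrefl _ hlt
    rw [this, smul_zero]
  · simp

lemma last_edge_mem {V : Type*} {G : SimpleGraph V} {a x : V} (p : G.Walk a x) (h : a ≠ x) :
    ∃ y, s(y, x) ∈ p.edges := by
  induction p with
  | nil => exact absurd rfl h
  | @cons u b c hadj q ih =>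
    by_cases hb : b = c
    · subst hb
      exact ⟨u, by simp⟩
    · obtain ⟨y, hy⟩ := ih hb
      exact ⟨y, by simp [hy]⟩

/-- Let `T` be a finite tree with vertices `v 0, v 1, …, v m` and edges `f 1, …, f m`,
let `w` be an integer weight on the edges and `ε` arbitrary signs.  If `M` is the
`m × m` matrix with `M j k = ε j k * w k` when the edge `f k` lies on the unique path
from `v 0` to `v (j+1)` and `M j k = 0` otherwise, then
`|det M| = ∏ k |w k|`. -/
theorem tree_evaluation_matrix_det
    {V : Type*} [Fintype V]
    (G : SimpleGraph V) (hT : G.IsTree)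
    (m : ℕ) (v : Fin (m + 1) → V) (hv : Function.Bijective v)
    (f : Fin m → Sym2 V) (hf : Function.Injective f)
    (hfe : ∀ k, f k ∈ G.edgeSet)
    (hfall : ∀ e ∈ G.edgeSet, ∃ k, f k = e)
    (w : Fin m → ℤ) (ε : Fin m → Fin m → ℤ)
    (hε : ∀ j k, ε j k = 1 ∨ ε j k = -1)
    (M : Matrix (Fin m) (Fin m) ℤ)
    (hM : ∀ j k : Fin m,
      ((∃ p : G.Walk (v 0) (v j.succ), p.IsPath ∧ f k ∈ p.edges) → M j k = ε j k * w k) ∧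
      ((¬ ∃ p : G.Walk (v 0) (v j.succ), p.IsPath ∧ f k ∈ p.edges) → M j k = 0)) :
    M.det.natAbs = ∏ k, (w k).natAbs := by
  choose P hP hU using fun x => hT.existsUnique_path (v 0) x
  have hlast : ∀ j : Fin m, ∃ k, ∃ y, f k = s(y, v j.succ) ∧ f k ∈ (P (v j.succ)).edges := by
    intro j
    obtain ⟨y, hy⟩ := last_edge_mem (P (v j.succ))
      (fun h => (Fin.succ_ne_zero j) (hv.1 h).symm)
    obtain ⟨k, hk⟩ := hfall _ ((P (v j.succ)).edges_subset_edgeSet hy)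
    exact ⟨k, y, hk, hk ▸ hy⟩
  choose σ Y hσ hσmem using hlast
  have key : ∀ j k, j ≠ k → f (σ k) ∈ (P (v j.succ)).edges →
      (P (v k.succ)).length < (P (v j.succ)).length := by
    intro j k hjk hmem
    rw [hσ] at hmem
    have hs : v k.succ ∈ (P (v j.succ)).support := SimpleGraph.Walk.snd_mem_support_of_mem_edges _ hmem
    have := hU _ _ ((hP (v j.succ)).takeUntil hs)
    rw [← this]
    apply SimpleGraph.Walk.length_takeUntil_lt_length
    intro h
    exact hjk (Fin.succ_injective _ (hv.1 h)).symm
  have hinj : Function.Injective σ := by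
    intro a b hab
    by_contra hne
    have h1 := key a b hne (hab ▸ hσmem a)
    have h2 := key b a (Ne.symm hne) (hab ▸ hσmem b)
    exact absurd h1 (not_lt.2 h2.le)
  let e : Equiv.Perm (Fin m) := Equiv.ofBijective σ (Finite.injective_iff_bijective.1 hinj)
  have hdet := det_of_depth (M.submatrix id e) (fun j => (P (v j.succ)).length) (by
    intro j k hjk hne
    apply key j k hjk
    by_contra hc
    apply hne
    apply (hM j (σ k)).2
    rintro ⟨p, hp, hmem⟩
    rw [hU _ p hp] at hmem
    exact hc hmem)
  rw [Matrix.det_permute'] at hdet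
  have h2 := congrArg Int.natAbs hdet
  rw [Int.natAbs_mul, Int.cast_id, Int.units_natAbs, one_mul] at h2
  rw [h2, ← Equiv.prod_comp e (fun k => (w k).natAbs), ← Int.natAbsHom_apply, map_prod]
  refine Finset.prod_congr rfl fun i _ => ?_
  have : M i (σ i) = ε i (σ i) * w (σ i) := (hM i (σ i)).1 ⟨_, hP _, hσmem i⟩
  change (M i (σ i)).natAbs = (w (σ i)).natAbs
  rw [this, Int.natAbs_mul]
  rcases hε i (σ i) with h | h <;> simp [h]
end

section
/- Let $N$ be a finite set and suppose $N = A_1 \sqcup A_2 \sqcup A_3 \sqcup A_4$ is a partition of $N$ into four pairwise disjoint subsets. Then, as functions on the 2-element subsets of $N$, $v_{A_1 \cup A_2} + v_{A_1 \cup A_3} + v_{A_2 \cup A_3} = v_{A_1} + v_{A_2} + v_{A_3} + v_{A_4}$. (This is the relation among the ray generators $v_I$ of tropical $\mathcal{M}_{0,N}$, [KM07, Lemma 2.6], used repeatedly in the balancing computations of Section 4 and in the proofs of Lemmas 5.2 and 5.3.) -/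
/-- The ray generator `v_I` of tropical `M_{0,N}`, as a function on (2-element) subsets
`{i, j}`: it is `1` if exactly one of `i, j` lies in `I`, and `0` otherwise. -/
def rayGen {α : Type*} [DecidableEq α] (I : Finset α) (i j : α) : ℤ :=
  if (i ∈ I ∧ j ∉ I) ∨ (i ∉ I ∧ j ∈ I) then 1 else 0

/-- For a partition `N = A₁ ⊔ A₂ ⊔ A₃ ⊔ A₄`, the relation
`v_{A₁∪A₂} + v_{A₁∪A₃} + v_{A₂∪A₃} = v_{A₁} + v_{A₂} + v_{A₃} + v_{A₄}`
holds as functions on 2-element subsets of `N`. -/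
theorem rayGen_four_part_relation {α : Type*} [Fintype α] [DecidableEq α]
    (A₁ A₂ A₃ A₄ : Finset α)
    (h12 : Disjoint A₁ A₂) (h13 : Disjoint A₁ A₃) (h14 : Disjoint A₁ A₄)
    (h23 : Disjoint A₂ A₃) (h24 : Disjoint A₂ A₄) (h34 : Disjoint A₃ A₄)
    (hcover : A₁ ∪ A₂ ∪ A₃ ∪ A₄ = Finset.univ) :
    ∀ i j : α, i ≠ j →
      rayGen (A₁ ∪ A₂) i j + rayGen (A₁ ∪ A₃) i j + rayGen (A₂ ∪ A₃) i j =
        rayGen A₁ i j + rayGen A₂ i j + rayGen A₃ i j + rayGen A₄ i j := by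
  intro i j _
  have key : ∀ x : α,
      (x ∈ A₁ ∧ x ∉ A₂ ∧ x ∉ A₃ ∧ x ∉ A₄) ∨ (x ∉ A₁ ∧ x ∈ A₂ ∧ x ∉ A₃ ∧ x ∉ A₄) ∨
      (x ∉ A₁ ∧ x ∉ A₂ ∧ x ∈ A₃ ∧ x ∉ A₄) ∨ (x ∉ A₁ ∧ x ∉ A₂ ∧ x ∉ A₃ ∧ x ∈ A₄) := by
    intro x
    have hx : x ∈ A₁ ∪ A₂ ∪ A₃ ∪ A₄ := by rw [hcover]; exact Finset.mem_univ x
    simp only [Finset.mem_union] at hx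
    rw [Finset.disjoint_left] at h12 h13 h14 h23 h24 h34
    have a := @h12 x
    have b := @h13 x
    have c := @h14 x
    have d := @h23 x
    have e := @h24 x
    have f := @h34 x
    clear hcover h12 h13 h14 h23 h24 h34
    grind
  rcases key i with ⟨a, b, c, d⟩ | ⟨a, b, c, d⟩ | ⟨a, b, c, d⟩ | ⟨a, b, c, d⟩ <;>
    rcases key j with ⟨e, f, g, h⟩ | ⟨e, f, g, h⟩ | ⟨e, f, g, h⟩ | ⟨e, f, g, h⟩ <;>
    simp [rayGen, a, b, c, d, e, f, g, h]
end

section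
/- Let $N$ be a finite set and suppose $N = A_1 \sqcup A_2 \sqcup A_3 \sqcup A_4 \sqcup \{\alpha\}$ is a partition of $N$ into four pairwise disjoint subsets $A_1,\dots,A_4$ together with a single element $\alpha$. Then, as functions on the 2-element subsets of $N$, $v_{A_1 \cup A_2} + v_{A_1 \cup A_3} + v_{A_2 \cup A_3} + v_{A_1 \cup A_2 \cup \{\alpha\}} + v_{A_1 \cup A_3 \cup \{\alpha\}} + v_{A_2 \cup A_3 \cup \{\alpha\}} = 2\,(v_{A_1} + v_{A_2} + v_{A_3} + v_{A_4}) + \delta_\alpha$, where $\delta_\alpha(\{i,j\}) = 1$ if $\alpha \in \{i,j\}$ and $0$ otherwise. In particular the two sides agree modulo functions of the form $\{i,j\} \mapsto a_i + a_j$. (This is the six-term relation computed in the proof of Lemma 5.3, used to determine the weight $-2$ in the intersection with a pulled-back boundary divisor.) -/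
/-- For a partition `N = A₁ ⊔ A₂ ⊔ A₃ ⊔ A₄ ⊔ {a}`, the six-term relation
`v_{A₁∪A₂} + v_{A₁∪A₃} + v_{A₂∪A₃} + v_{A₁∪A₂∪{a}} + v_{A₁∪A₃∪{a}} + v_{A₂∪A₃∪{a}}
  = 2(v_{A₁} + v_{A₂} + v_{A₃} + v_{A₄}) + δ_a`
holds as functions on 2-element subsets of `N`, where `δ_a({i,j}) = 1` iff `a ∈ {i,j}`. -/
theorem rayGen_six_term_relation {α : Type*} [Fintype α] [DecidableEq α]
    (A₁ A₂ A₃ A₄ : Finset α) (a : α)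
    (h12 : Disjoint A₁ A₂) (h13 : Disjoint A₁ A₃) (h14 : Disjoint A₁ A₄)
    (h23 : Disjoint A₂ A₃) (h24 : Disjoint A₂ A₄) (h34 : Disjoint A₃ A₄)
    (ha1 : a ∉ A₁) (ha2 : a ∉ A₂) (ha3 : a ∉ A₃) (ha4 : a ∉ A₄)
    (hcover : A₁ ∪ A₂ ∪ A₃ ∪ A₄ ∪ {a} = Finset.univ) :
    ∀ i j : α, i ≠ j →
      rayGen (A₁ ∪ A₂) i j + rayGen (A₁ ∪ A₃) i j + rayGen (A₂ ∪ A₃) i j +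
          rayGen (insert a (A₁ ∪ A₂)) i j + rayGen (insert a (A₁ ∪ A₃)) i j +
          rayGen (insert a (A₂ ∪ A₃)) i j =
        2 * (rayGen A₁ i j + rayGen A₂ i j + rayGen A₃ i j + rayGen A₄ i j) +
          (if i = a ∨ j = a then 1 else 0) := by
  intro i j hij
  have key : ∀ x : α,
      (x ∈ A₁ ∧ x ∉ A₂ ∧ x ∉ A₃ ∧ x ∉ A₄ ∧ x ≠ a) ∨
      (x ∉ A₁ ∧ x ∈ A₂ ∧ x ∉ A₃ ∧ x ∉ A₄ ∧ x ≠ a) ∨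
      (x ∉ A₁ ∧ x ∉ A₂ ∧ x ∈ A₃ ∧ x ∉ A₄ ∧ x ≠ a) ∨
      (x ∉ A₁ ∧ x ∉ A₂ ∧ x ∉ A₃ ∧ x ∈ A₄ ∧ x ≠ a) ∨
      (x ∉ A₁ ∧ x ∉ A₂ ∧ x ∉ A₃ ∧ x ∉ A₄ ∧ x = a) := by
    intro x
    have hx : x ∈ A₁ ∪ A₂ ∪ A₃ ∪ A₄ ∪ {a} := hcover ▸ Finset.mem_univ x
    simp only [Finset.mem_union, Finset.mem_singleton] at hx
    rw [Finset.disjoint_left] at h12 h13 h14 h23 h24 h34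
    have e12 := @h12 x
    have e13 := @h13 x
    have e14 := @h14 x
    have e23 := @h23 x
    have e24 := @h24 x
    have e34 := @h34 x
    clear h12 h13 h14 h23 h24 h34 hcover
    rcases hx with (((hx | hx) | hx) | hx) | hx <;> grind
  unfold rayGen
  rcases key i with h | h | h | h | h <;> rcases key j with h' | h' | h' | h' | h' <;>
    obtain ⟨p1, p2, p3, p4, p5⟩ := h <;> obtain ⟨q1, q2, q3, q4, q5⟩ := h' <;>
    first
    | exact absurd (p5.trans q5.symm) hij
    | simp only [Finset.mem_union, Finset.mem_insert, p1, p2, p3, p4, p5, q1, q2, q3, q4, q5,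
        ha1, ha2, ha3, ha4] <;> norm_num
end

section
/- Fix a finite tree $\Gamma$ with $n$ leaves labelled $1,\dots,n$ and all internal vertices of degree at least $3$, and fix a chamber $\mathfrak{c}$. Then: (i) for all integer points $x \in \mathfrak{c} \cap \mathbb{Z}^n$, the orientation of each internal edge $e$ of $\Gamma$ determined by the sign of $\sum_{i \in I_e} x_i$ is the same; hence the number $m_\mathfrak{c}(\Gamma)$ of total orderings of the internal vertices of $\Gamma$ compatible with this orientation is well defined and depends only on $\mathfrak{c}$; and (ii) the function $x \mapsto m_\mathfrak{c}(\Gamma)\, \varphi_\Gamma(x)\, \prod_{v \text{ internal}} (\deg(v) - 2)$ agrees on $\mathfrak{c} \cap \mathbb{Z}^n$ with a homogeneous polynomial in $x_1,\dots,x_n$ of degree equal to the number of internal edges of $\Gamma$; in particular, if $\Gamma$ has $n - 2 - k$ internal vertices, this degree is $n - 3 - k$. (This is the combinatorial content of Theorem 3.4 and Lemma 3.7: on each chamber, the coefficient of the boundary stratum $\Delta_\Gamma$ in the Hurwitz cycle $\mathbb{H}_k(\mathbf{x})$ is the homogeneous degree-$(n-3-k)$ polynomial $m_\mathfrak{c}(\Gamma)\,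 \varphi(\Gamma)\, \prod_v (\mathrm{val}(v) - 2)$.) -/
open scoped Classical

noncomputable section

/-- The hyperplane `H = {x : ∑ xᵢ = 0}` of special ramification data. -/
def Hset (n : ℕ) : Set (Fin n → ℝ) := {x | ∑ i, x i = 0}

/-- The union of the walls `W_I = {∑_{i ∈ I} xᵢ = 0}` over nonempty proper `I`. -/
def Walls (n : ℕ) : Set (Fin n → ℝ) :=
  {x | ∃ I : Finset (Fin n), I.Nonempty ∧ I ≠ Finset.univ ∧ ∑ i ∈ I, x i = 0}

/-- A chamber of polynomiality: a connected component of `H ∖ ⋃ W_I`. -/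
def IsChamber {n : ℕ} (c : Set (Fin n → ℝ)) : Prop :=
  ∃ x₀ ∈ Hset n \ Walls n, c = connectedComponentIn (Hset n \ Walls n) x₀

/-- Given a labelling `lab` of the leaves of a tree `G` by `Fin n`, the set of labels
of leaves lying on the `u`-side of the edge `{u, v}`. -/
def sideLabels {V : Type*} [Fintype V] (G : SimpleGraph V) {n : ℕ}
    (lab : Fin n ≃ {v : V // G.degree v = 1}) (u v : V) : Finset (Fin n) :=
  Finset.univ.filter fun i => (G.deleteEdges {s(u, v)}).Reachable u (lab i).1

/-- The internal edges of `G`, recorded as ordered pairs `(u, v)` with `u < v` (thus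
fixing one side of each internal edge). -/
def internalEdgePairs {V : Type*} [Fintype V] [LinearOrder V] (G : SimpleGraph V) :
    Finset (V × V) :=
  Finset.univ.filter fun p =>
    p.1 < p.2 ∧ G.Adj p.1 p.2 ∧ G.degree p.1 ≠ 1 ∧ G.degree p.2 ≠ 1

/-- The number of total orderings of the internal vertices of the tree `G` compatible
with the orientation of the internal edges determined by `x`: each internal edge
`{u, v}` whose `u`-side label sum is positive must point from the earlier vertex `u`
to the later vertex `v`. -/
def numCompatibleOrderings {V : Type*} [Fintype V] (G : SimpleGraph V) {n : ℕ}
    (lab : Fin n ≃ {v : V // G.degree v = 1}) (x : Fin n → ℤ) : ℕ :=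
  Nat.card {σ : {v : V // G.degree v ≠ 1} ≃ Fin (Fintype.card {v : V // G.degree v ≠ 1}) //
    ∀ u v : {v : V // G.degree v ≠ 1}, G.Adj u.1 v.1 →
      0 < ∑ i ∈ sideLabels G lab u.1 v.1, x i → σ u < σ v}

/-- The sign of every partial label sum is constant on the integer points of a chamber. -/
theorem chamber_sign_const {n : ℕ} {c : Set (Fin n → ℝ)} (hc : IsChamber c)
    (I : Finset (Fin n)) (x y : Fin n → ℤ)
    (hx : (fun i => (x i : ℝ)) ∈ c) (hy : (fun i => (y i : ℝ)) ∈ c)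
    (h : 0 < ∑ i ∈ I, x i) : 0 < ∑ i ∈ I, y i := by
  obtain ⟨x₀, hx₀, rfl⟩ := hc
  have hsub := connectedComponentIn_subset (Hset n \ Walls n) x₀
  have hpre : IsPreconnected (connectedComponentIn (Hset n \ Walls n) x₀) :=
    isPreconnected_connectedComponentIn
  have hIne : I.Nonempty := by
    rw [Finset.nonempty_iff_ne_empty]
    rintro rfl
    simp at h
  have hIu : I ≠ Finset.univ := by
    rintro rfl
    have h1 : ∑ i, (x i : ℝ) = 0 := (hsub hx).1
    have h2 : ∑ i, x i = 0 := by exact_mod_cast h1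
    omega
  by_contra hy0
  have hcont : ContinuousOn (fun z : Fin n → ℝ => ∑ i ∈ I, z i)
      (connectedComponentIn (Hset n \ Walls n) x₀) := by
    apply Continuous.continuousOn
    fun_prop
  have hmem : (0 : ℝ) ∈ Set.Icc (∑ i ∈ I, (y i : ℝ)) (∑ i ∈ I, (x i : ℝ)) := by
    constructor
    · exact_mod_cast not_lt.mp hy0
    · exact_mod_cast h.le
  obtain ⟨z, hz, hz0⟩ := hpre.intermediate_value hy hx hcont hmem
  exact (hsub hz).2 ⟨I, hIne, hIu, hz0⟩

/-- The number of internal edges of a tree is one less than that of internal vertices. -/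
theorem card_internalEdgePairs {V : Type*} [Fintype V] [LinearOrder V]
    (G : SimpleGraph V) (hT : G.IsTree) :
    (internalEdgePairs G).card =
      (Finset.univ.filter (fun v : V => G.degree v ≠ 1)).card - 1 := by
  let S : Set V := {v | G.degree v ≠ 1}
  have hbij : (internalEdgePairs G).card = (G.induce S).edgeFinset.card := by
    refine Finset.card_bij
      (fun p hp => s((⟨p.1, (Finset.mem_filter.mp hp).2.2.2.1⟩ : S),
        (⟨p.2, (Finset.mem_filter.mp hp).2.2.2.2⟩ : S))) ?_ ?_ ?_
    · intro p hp
      have := (Finset.mem_filter.mp hp).2.2.1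
      simpa [SimpleGraph.mem_edgeFinset] using this
    · intro p hp q hq h
      have h1 := (Finset.mem_filter.mp hp).2.1
      have h2 := (Finset.mem_filter.mp hq).2.1
      rw [Sym2.eq_iff] at h
      rcases h with ⟨ha, hb⟩ | ⟨ha, hb⟩
      · exact Prod.ext (congrArg Subtype.val ha) (congrArg Subtype.val hb)
      · have ha' : p.1 = q.2 := congrArg Subtype.val ha
        have hb' : p.2 = q.1 := congrArg Subtype.val hb
        rw [ha', hb'] at h1
        exact absurd h1 (lt_asymm h2)
    · intro e he
      induction e using Sym2.ind with
      | _ a b =>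
        have hadj : G.Adj a.1 b.1 := by
          simpa [SimpleGraph.mem_edgeFinset] using he
        rcases lt_or_gt_of_ne hadj.ne with hlt | hlt
        · exact ⟨(a.1, b.1), Finset.mem_filter.mpr
            ⟨Finset.mem_univ _, hlt, hadj, a.2, b.2⟩, rfl⟩
        · exact ⟨(b.1, a.1), Finset.mem_filter.mpr
            ⟨Finset.mem_univ _, hlt, hadj.symm, b.2, a.2⟩, Sym2.eq_swap⟩
  have hS : (Finset.univ.filter (fun v : V => G.degree v ≠ 1)).card = Fintype.card S := by
    rw [Fintype.card_subtype]
    rfl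
  rw [hbij, hS]
  rcases isEmpty_or_nonempty S with hE | hN
  · have h0 : (G.induce S).edgeFinset = ∅ := by
      ext e
      induction e using Sym2.ind with
      | _ a b => exact hE.elim a
    simp [h0]
  · have hpre : (G.induce S).Preconnected := by
      apply hT.connected.preconnected.induce_of_degree_eq_one
      intro v hv
      have hv1 : G.degree v = 1 := not_not.mp hv
      obtain ⟨w, -, hw⟩ := SimpleGraph.degree_eq_one_iff_existsUnique_adj.mp hv1
      intro a ha b hb
      rw [hw a ha, hw b hb]
    have htree : (G.induce S).IsTree := ⟨⟨hpre⟩, hT.isAcyclic.induce S⟩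
    have := htree.card_edgeFinset
    omega

/-- On each chamber `c`: (i) the orientations of the internal edges of a tree `Γ`
determined by the signs of the side sums are the same for all integer points of `c`,
hence the number `m_c(Γ)` of compatible orderings is well defined on `c`; and (ii)
`x ↦ m_c(Γ) · φ_Γ(x) · ∏_v (deg v - 2)` agrees on the integer points of `c` with a
homogeneous polynomial of degree the number of internal edges of `Γ`; in particular
if `Γ` has `n - 2 - k` internal vertices this degree is `n - 3 - k`. -/
theorem chamber_orientation_and_polynomial_coefficient
    {V : Type*} [Fintype V] [LinearOrder V]
    (G : SimpleGraph V) (hT : G.IsTree)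
    (hdeg : ∀ v : V, G.degree v ≠ 1 → 3 ≤ G.degree v)
    {n : ℕ} (lab : Fin n ≃ {v : V // G.degree v = 1})
    (c : Set (Fin n → ℝ)) (hc : IsChamber c) :
    -- (i) the orientation of each internal edge is the same for all integer points of `c`
    (∀ x y : Fin n → ℤ,
      (fun i => (x i : ℝ)) ∈ c → (fun i => (y i : ℝ)) ∈ c →
      ∀ u v : V, G.Adj u v → G.degree u ≠ 1 → G.degree v ≠ 1 →
        (0 < ∑ i ∈ sideLabels G lab u v, x i ↔ 0 < ∑ i ∈ sideLabels G lab u v, y i)) ∧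
    -- hence `m_c(Γ)` is well defined, depending only on the chamber
    (∀ x y : Fin n → ℤ,
      (fun i => (x i : ℝ)) ∈ c → (fun i => (y i : ℝ)) ∈ c →
      numCompatibleOrderings G lab x = numCompatibleOrderings G lab y) ∧
    -- (ii) the coefficient is a homogeneous polynomial of degree the number of
    -- internal edges on the integer points of `c`
    (∃ P : MvPolynomial (Fin n) ℤ,
      P.IsHomogeneous (internalEdgePairs G).card ∧
      ∀ x : Fin n → ℤ, (fun i => (x i : ℝ)) ∈ c →
        MvPolynomial.eval x P =
          (numCompatibleOrderings G lab x : ℤ) *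
            (∏ p ∈ internalEdgePairs G, |∑ i ∈ sideLabels G lab p.1 p.2, x i|) *
            ∏ v ∈ Finset.univ.filter (fun v : V => G.degree v ≠ 1),
              ((G.degree v : ℤ) - 2)) ∧
    -- in particular: `n - 2 - k` internal vertices give `n - 3 - k` internal edges
    (∀ k : ℕ, (Finset.univ.filter (fun v : V => G.degree v ≠ 1)).card = n - 2 - k →
      (internalEdgePairs G).card = n - 3 - k) := by
  have hsign : ∀ (I : Finset (Fin n)) (x y : Fin n → ℤ),
      (fun i => (x i : ℝ)) ∈ c → (fun i => (y i : ℝ)) ∈ c →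
      (0 < ∑ i ∈ I, x i ↔ 0 < ∑ i ∈ I, y i) := fun I x y hx hy =>
    ⟨chamber_sign_const hc I x y hx hy, chamber_sign_const hc I y x hy hx⟩
  have hnum : ∀ x y : Fin n → ℤ,
      (fun i => (x i : ℝ)) ∈ c → (fun i => (y i : ℝ)) ∈ c →
      numCompatibleOrderings G lab x = numCompatibleOrderings G lab y := by
    intro x y hx hy
    unfold numCompatibleOrderings
    simp only [hsign _ x y hx hy]
  refine ⟨fun x y hx hy u v _ _ _ => hsign _ x y hx hy, hnum, ?_, ?_⟩
  · by_cases hex : ∃ x : Fin n → ℤ, (fun i => (x i : ℝ)) ∈ c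
    · obtain ⟨x₀, hx₀⟩ := hex
      let ε : V × V → ℤ := fun p =>
        if 0 < ∑ i ∈ sideLabels G lab p.1 p.2, x₀ i then 1 else -1
      let D : ℤ := ∏ v ∈ Finset.univ.filter (fun v : V => G.degree v ≠ 1),
        ((G.degree v : ℤ) - 2)
      refine ⟨MvPolynomial.C ((numCompatibleOrderings G lab x₀ : ℤ) * D) *
        ∏ p ∈ internalEdgePairs G, (MvPolynomial.C (ε p) *
          ∑ i ∈ sideLabels G lab p.1 p.2, MvPolynomial.X i), ?_, ?_⟩
      · have h1 : (∏ p ∈ internalEdgePairs G, (MvPolynomial.C (ε p) *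
            ∑ i ∈ sideLabels G lab p.1 p.2,
              (MvPolynomial.X i : MvPolynomial (Fin n) ℤ))).IsHomogeneous
            (∑ _p ∈ internalEdgePairs G, 1) := by
          apply MvPolynomial.IsHomogeneous.prod
          intro p _
          exact MvPolynomial.IsHomogeneous.C_mul
            (MvPolynomial.IsHomogeneous.sum _ _ _
              fun i _ => MvPolynomial.isHomogeneous_X _ _) _
        rw [Finset.sum_const, smul_eq_mul, mul_one] at h1
        exact h1.C_mul _
      · intro x hx
        rw [hnum x x₀ hx hx₀]
        have h2 : ∀ p ∈ internalEdgePairs G,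
            ε p * ∑ i ∈ sideLabels G lab p.1 p.2, x i
              = |∑ i ∈ sideLabels G lab p.1 p.2, x i| := by
          intro p _
          have hs := hsign (sideLabels G lab p.1 p.2) x x₀ hx hx₀
          by_cases hp : 0 < ∑ i ∈ sideLabels G lab p.1 p.2, x₀ i
          · simp only [ε, if_pos hp]
            rw [abs_of_pos (hs.mpr hp), one_mul]
          · simp only [ε, if_neg hp]
            rw [abs_of_nonpos (not_lt.mp fun h => hp (hs.mp h)), neg_one_mul]
        rw [← Finset.prod_congr rfl h2]
        simp only [map_mul, map_prod, map_sum, MvPolynomial.eval_C, MvPolynomial.eval_X]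
        simp only [D]
        ring
    · exact ⟨0, MvPolynomial.isHomogeneous_zero _ _ _, fun x hx => absurd ⟨x, hx⟩ hex⟩
  · intro k hk
    rw [card_internalEdgePairs G hT, hk]
    omega
end
end
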